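/- The order of PSL(2,8) multiplied by 3 divides the order of PSU(3,8); indeed PSU(3,8) contains a subgroup isomorphic to PSL(2,8) × ℤ/3. -/

import Mathlib

open Matrix

/-- The field with 64 elements. -/
abbrev GF64 := GaloisField 2 6

noncomputable instance : Fintype GF64 := Fintype.ofFinite _

/-- The star operation `x ↦ x⁸` on `GF(64)`, i.e. the order-2 field automorphism. -/
noncomputable instance : StarRing GF64 where
  star x := x ^ 8
  star_involutive x := by
    show (x ^ 8) ^ 8 = x
    have hcard : Fintype.card GF64 = 64 := by
      simpa using GaloisField.card 2 6 (by norm_num)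
    calc (x ^ 8) ^ 8 = x ^ Fintype.card GF64 := by rw [hcard]; ring
      _ = x := FiniteField.pow_card x
  star_mul x y := by show (x * y) ^ 8 = y ^ 8 * x ^ 8; ring
  star_add x y := by
    show (x + y) ^ 8 = x ^ 8 + y ^ 8
    have h : Fact (Nat.Prime 2) := ⟨by norm_num⟩
    have := add_pow_char_pow (R := GF64) (p := 2) (n := 3) (x := x) (y := y)
    norm_num at this
    exact this

/-- The special unitary group SU(3,8). -/
noncomputable def SU38 : Subgroup (Matrix.unitaryGroup (Fin 3) GF64) :=
  MonoidHom.ker (Matrix.detMonoidHom.comp (Matrix.unitaryGroup (Fin 3) GF64).subtype)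

/-- The projective special unitary group PSU(3,8). -/
noncomputable abbrev PSU38 := SU38 ⧸ Subgroup.center SU38

/-- PSL(2,8). -/
abbrev PSL28 := Matrix.ProjectiveSpecialLinearGroup (Fin 2) (GaloisField 2 3)



lemma GF64.star_def (x : GF64) : star x = x ^ 8 := rfl

lemma GF64.exists_orderOf_eq_nine : ∃ u : GF64ˣ, orderOf u = 9 := by
  obtain ⟨g, hg⟩ := IsCyclic.exists_ofOrder_eq_natCard (α := GF64ˣ)
  have hcard : orderOf g = 63 := by
    rw [hg, Nat.card_units, GaloisField.card 2 6 (by norm_num)]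
    norm_num
  exact ⟨g ^ 7, by rw [orderOf_pow, hcard]; norm_num⟩

lemma exists_ringHom_pow_eight : ∃ e : GaloisField 2 3 →+* GF64, ∀ x, e x ^ 8 = e x := by
  obtain ⟨e⟩ := FiniteField.nonempty_algHom_of_finrank_dvd (F := ZMod 2) (K := GaloisField 2 3)
    (L := GF64) (by
      rw [GaloisField.finrank 2 (by norm_num), GaloisField.finrank 2 (by norm_num)]; norm_num)
  refine ⟨e.toRingHom, fun x ↦ ?_⟩
  have := Fintype.ofFinite (GaloisField 2 3)
  have hcard : Fintype.card (GaloisField 2 3) = 8 := by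
    rw [← Nat.card_eq_fintype_card, GaloisField.card 2 3 (by norm_num)]; norm_num
  rw [← map_pow, ← hcard, FiniteField.pow_card]

lemma center_SL28_eq_bot :
    Subgroup.center (Matrix.SpecialLinearGroup (Fin 2) (GaloisField 2 3)) = ⊥ := by
  refine eq_bot_iff.mpr fun A hA ↦ ?_
  obtain ⟨r, hr, hA⟩ := Matrix.SpecialLinearGroup.mem_center_iff.mp hA
  have : r = 1 := by
    have h2 : (2 : GaloisField 2 3) = 0 := CharTwo.two_eq_zero
    have : (r - 1) ^ 2 = 0 := by
      rw [Fintype.card_fin] at hr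
      linear_combination hr + (1 - r) * h2
    exact sub_eq_zero.mp (pow_eq_zero_iff two_ne_zero |>.mp this)
  rw [Subgroup.mem_bot]
  ext1
  simp [← hA, this]

/-- An element of `SU(3,8)` from a unitary matrix of determinant one. -/
noncomputable def SU38.mk (X : Matrix (Fin 3) (Fin 3) GF64) (h : star X * X = 1)
    (hdet : X.det = 1) : SU38 :=
  ⟨⟨X, mem_unitaryGroup_iff'.mpr h⟩, hdet⟩

/-- The underlying matrix of an element of `SU(3,8)`. -/
noncomputable def SU38.toMatrix : SU38 →* Matrix (Fin 3) (Fin 3) GF64 :=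
  (unitaryGroup (Fin 3) GF64).subtype.comp SU38.subtype

lemma SU38.toMatrix_injective : Function.Injective SU38.toMatrix :=
  Subtype.val_injective.comp Subtype.val_injective

@[simp]
lemma SU38.toMatrix_mk (X h hdet) : SU38.toMatrix (SU38.mk X h hdet) = X := rfl

/-- The cyclic permutation matrix. -/
noncomputable def SU38.cyc : SU38 :=
  SU38.mk !![0, 1, 0; 0, 0, 1; 1, 0, 0]
    (by
      ext i j
      fin_cases i <;> fin_cases j <;>
        simp [star_eq_conjTranspose, Matrix.mul_apply, Fin.sum_univ_three])
    (by simp [det_fin_three])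

/-- The block embedding of `2 × 2` matrices over `GF(8)` into `3 × 3` matrices over `GF(64)`. -/
noncomputable def blockEmb (e : GaloisField 2 3 →+* GF64) (A : Matrix (Fin 2) (Fin 2) (GaloisField 2 3)) :
    Matrix (Fin 3) (Fin 3) GF64 :=
  !![e (A 0 0), e (A 0 1), 0; e (A 1 0), e (A 1 1), 0; 0, 0, 1]

lemma blockEmb_mul (e A B) : blockEmb e (A * B) = blockEmb e A * blockEmb e B := by
  ext i j
  fin_cases i <;> fin_cases j <;> simp [blockEmb, Matrix.mul_apply, Fin.sum_univ_succ]

lemma blockEmb_one (e) : blockEmb e 1 = 1 := by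
  ext i j
  fin_cases i <;> fin_cases j <;> simp [blockEmb]

/-- The Gram matrix of a hermitian form preserved by the image of `SL(2,8)`. -/
noncomputable def hermGram : Matrix (Fin 3) (Fin 3) GF64 := !![0, 1, 0; 1, 0, 0; 0, 0, 1]

lemma star_blockEmb_mul (e : GaloisField 2 3 →+* GF64) (he : ∀ x, e x ^ 8 = e x)
    (A : Matrix.SpecialLinearGroup (Fin 2) (GaloisField 2 3)) :
    star (blockEmb e A) * hermGram * blockEmb e A = hermGram := by
  have h2 : (2 : GF64) = 0 := CharTwo.two_eq_zero
  have hd := congrArg e A.det_coe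
  rw [det_fin_two] at hd
  simp only [map_sub, map_mul, map_one] at hd
  ext i j
  fin_cases i <;> fin_cases j <;>
    simp [blockEmb, hermGram, star_eq_conjTranspose, Matrix.mul_apply, Fin.sum_univ_three,
      GF64.star_def, he]
  · linear_combination e (A 0 0) * e (A 1 0) * h2
  · linear_combination hd + e (A 0 1) * e (A 1 0) * h2
  · linear_combination hd + e (A 0 1) * e (A 1 0) * h2
  · linear_combination e (A 0 1) * e (A 1 1) * h2

lemma det_blockEmb (e : GaloisField 2 3 →+* GF64)
    (A : Matrix.SpecialLinearGroup (Fin 2) (GaloisField 2 3)) : (blockEmb e A).det = 1 := by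
  have hd := congrArg e A.det_coe
  rw [det_fin_two] at hd
  simp only [map_sub, map_mul, map_one] at hd
  simp [blockEmb, det_fin_three, hd]

/-- The base change from an orthonormal basis to one with Gram matrix `hermGram`. -/
noncomputable def baseChange (w : GF64) : Matrix (Fin 3) (Fin 3) GF64 := !![1, w, 0; 1, w ^ 2, 0; 0, 0, 1]

/-- The inverse of `baseChange`. -/
noncomputable def baseChangeInv (w : GF64) : Matrix (Fin 3) (Fin 3) GF64 := !![w ^ 2, w, 0; 1, 1, 0; 0, 0, 1]

lemma baseChange_mul_inv {w : GF64} (hw : w ^ 2 + w + 1 = 0) :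
    baseChange w * baseChangeInv w = 1 := by
  have h2 : (2 : GF64) = 0 := CharTwo.two_eq_zero
  ext i j
  fin_cases i <;> fin_cases j <;>
    simp [baseChange, baseChangeInv, Matrix.mul_apply, Fin.sum_univ_three]
  · linear_combination hw - h2
  · linear_combination w * h2
  · linear_combination w ^ 2 * h2
  · linear_combination hw - h2

lemma baseChangeInv_mul {w : GF64} (hw : w ^ 2 + w + 1 = 0) :
    baseChangeInv w * baseChange w = 1 :=
  mul_eq_one_comm.mp (baseChange_mul_inv hw)

lemma star_baseChange_mul {w : GF64} (hw : w ^ 2 + w + 1 = 0) :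
    star (baseChange w) * baseChange w = hermGram := by
  have h2 : (2 : GF64) = 0 := CharTwo.two_eq_zero
  have h3 : w ^ 3 = 1 := by linear_combination (w - 1) * hw
  have h8 : w ^ 8 = w ^ 2 := by linear_combination w ^ 2 * (w ^ 3 + 1) * h3
  have h16 : (w ^ 2) ^ 8 = w := by
    linear_combination w * (w ^ 12 + w ^ 9 + w ^ 6 + w ^ 3 + 1) * h3
  ext i j
  fin_cases i <;> fin_cases j <;>
    simp [baseChange, hermGram, star_eq_conjTranspose, Matrix.mul_apply, Fin.sum_univ_three,
      GF64.star_def, h8, h16]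
  · linear_combination h2
  · linear_combination hw - h2
  · linear_combination hw - h2
  · linear_combination w ^ 3 * h2

/-- The embedding of `SL(2,8)` into `SU(3,8)`. -/
noncomputable def SL28.toSU38 (e : GaloisField 2 3 →+* GF64) (he : ∀ x, e x ^ 8 = e x) {w : GF64}
    (hw : w ^ 2 + w + 1 = 0) : Matrix.SpecialLinearGroup (Fin 2) (GaloisField 2 3) →* SU38 where
  toFun A := SU38.mk (baseChange w * blockEmb e A * baseChangeInv w)
    (by
      calc star (baseChange w * blockEmb e A * baseChangeInv w) *
            (baseChange w * blockEmb e A * baseChangeInv w)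
          = star (baseChangeInv w) * (star (blockEmb e A) *
              (star (baseChange w) * baseChange w) * blockEmb e A) * baseChangeInv w := by
            simp only [star_mul, Matrix.mul_assoc]
        _ = star (baseChange w * baseChangeInv w) * (baseChange w * baseChangeInv w) := by
            rw [star_baseChange_mul hw, star_blockEmb_mul e he, ← star_baseChange_mul hw]
            simp only [star_mul, Matrix.mul_assoc]
        _ = 1 := by simp [baseChange_mul_inv hw])
    (by
      rw [det_mul, det_mul, det_blockEmb, mul_one, ← det_mul, baseChange_mul_inv hw, det_one])
  map_one' := SU38.toMatrix_injective <| by simp [blockEmb_one, baseChange_mul_inv hw]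
  map_mul' A B := SU38.toMatrix_injective <| by
    rw [map_mul]
    simp only [SU38.toMatrix_mk, Matrix.SpecialLinearGroup.coe_mul, blockEmb_mul]
    calc _ = baseChange w * blockEmb e A * 1 * blockEmb e B * baseChangeInv w := by
            simp only [Matrix.mul_assoc, Matrix.one_mul]
      _ = _ := by
            rw [← baseChangeInv_mul hw]
            simp only [Matrix.mul_assoc]

lemma rootsOfUnity_nine_pow (u : rootsOfUnity 9 GF64) : (u.1 : GF64) ^ 9 = 1 := by
  exact congrArg Units.val ((mem_rootsOfUnity 9 _).mp u.2)

/-- The diagonal torus of order nine centralizing the image of `SL(2,8)`. -/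
noncomputable def torus : rootsOfUnity 9 GF64 →* SU38 where
  toFun u := SU38.mk (diagonal ![(u.1 : GF64), u.1, (u.1 : GF64) ^ 7])
    (by
      have hu : (u.1 : GF64) ^ 9 = 1 := rootsOfUnity_nine_pow u
      ext i j
      fin_cases i <;> fin_cases j <;> simp [star_eq_conjTranspose, GF64.star_def]
      · linear_combination hu
      · linear_combination hu
      · linear_combination ((u.1 : GF64) ^ 54 + (u.1 : GF64) ^ 45 + (u.1 : GF64) ^ 36
          + (u.1 : GF64) ^ 27 + (u.1 : GF64) ^ 18 + (u.1 : GF64) ^ 9 + 1) * hu)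
    (by
      have hu : (u.1 : GF64) ^ 9 = 1 := rootsOfUnity_nine_pow u
      simp [det_diagonal, Fin.prod_univ_three]
      linear_combination hu)
  map_one' := SU38.toMatrix_injective <| by
    ext i j
    fin_cases i <;> fin_cases j <;> simp
  map_mul' u v := SU38.toMatrix_injective <| by
    simp only [SU38.toMatrix_mk, map_mul, diagonal_mul_diagonal]
    congr 1
    ext i
    fin_cases i <;> simp [mul_pow]

lemma toMatrix_torus (u : rootsOfUnity 9 GF64) :
    SU38.toMatrix (torus u) = diagonal ![(u.1 : GF64), u.1, (u.1 : GF64) ^ 7] := rfl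

lemma toMatrix_toSU38 (e : GaloisField 2 3 →+* GF64) (he : ∀ x, e x ^ 8 = e x) {w : GF64}
    (hw : w ^ 2 + w + 1 = 0) (A) : SU38.toMatrix (SL28.toSU38 e he hw A) =
      baseChange w * blockEmb e A * baseChangeInv w := rfl

lemma blockEmb_mul_diagonal (e A) (a b : GF64) :
    blockEmb e A * diagonal ![a, a, b] = diagonal ![a, a, b] * blockEmb e A := by
  ext i j
  fin_cases i <;> fin_cases j <;> simp [blockEmb, mul_comm]

lemma baseChange_mul_diagonal (w a b : GF64) :
    baseChange w * diagonal ![a, a, b] = diagonal ![a, a, b] * baseChange w := by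
  ext i j
  fin_cases i <;> fin_cases j <;> simp [baseChange, mul_comm]

lemma baseChangeInv_mul_diagonal (w a b : GF64) :
    baseChangeInv w * diagonal ![a, a, b] = diagonal ![a, a, b] * baseChangeInv w := by
  ext i j
  fin_cases i <;> fin_cases j <;> simp [baseChangeInv, mul_comm]

section Embedding

variable (e : GaloisField 2 3 →+* GF64) (he : ∀ x, e x ^ 8 = e x) {w : GF64}
  (hw : w ^ 2 + w + 1 = 0)

lemma commute_toSU38_torus (A) (u) : Commute (SL28.toSU38 e he hw A) (torus u) :=
  SU38.toMatrix_injective <| by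
    rw [map_mul, map_mul, toMatrix_torus, toMatrix_toSU38, Matrix.mul_assoc,
      baseChangeInv_mul_diagonal, ← Matrix.mul_assoc, Matrix.mul_assoc (baseChange w),
      blockEmb_mul_diagonal, ← Matrix.mul_assoc, baseChange_mul_diagonal]
    simp only [Matrix.mul_assoc]

lemma torus_mem_center {u : rootsOfUnity 9 GF64} (hu : u ^ 3 = 1) :
    torus u ∈ Subgroup.center SU38 := by
  have h : (u.1 : GF64) ^ 3 = 1 := by
    exact congrArg (fun v : rootsOfUnity 9 GF64 ↦ (v.1 : GF64)) hu
  refine Subgroup.mem_center_iff.mpr fun g ↦ SU38.toMatrix_injective ?_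
  have hs : ![(u.1 : GF64), u.1, (u.1 : GF64) ^ 7] = fun _ ↦ (u.1 : GF64) := by
    ext i
    fin_cases i <;> simp
    linear_combination (u.1 : GF64) * ((u.1 : GF64) ^ 3 + 1) * h
  rw [map_mul, map_mul, toMatrix_torus, hs]
  exact (scalar_commute (u.1 : GF64) (Commute.all _) _).symm

/-- A matrix commuting with the cyclic permutation matrix and with vanishing entries outside
the diagonal blocks is scalar. -/
lemma eq_scalar_of_commute_cyc {X : Matrix (Fin 3) (Fin 3) GF64}
    (h : SU38.toMatrix SU38.cyc * X = X * SU38.toMatrix SU38.cyc) (h0 : X 0 2 = 0)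
    (h1 : X 1 2 = 0) : X = X 2 2 • (1 : Matrix (Fin 3) (Fin 3) GF64) := by
  have H := fun i j ↦ congrFun (congrFun h i) j
  have a00 := H 0 1
  have a01 := H 0 2
  have a02 := H 0 0
  have a10 := H 1 1
  have a11 := H 1 2
  have a12 := H 1 0
  have a20 := H 2 1
  have a21 := H 2 2
  have a22 := H 2 0
  simp [SU38.cyc, Matrix.mul_apply, Fin.sum_univ_three] at a00 a01 a02 a10 a11 a12 a20 a21 a22
  ext i j
  fin_cases i <;> fin_cases j <;> simp <;> grind

lemma eq_one_of_mul_torus_mem_center {A} {u : rootsOfUnity 9 GF64}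
    (h : SL28.toSU38 e he hw A * torus u ∈ Subgroup.center SU38) : A = 1 ∧ u ^ 3 = 1 := by
  have h9 : (u.1 : GF64) ^ 9 = 1 := rootsOfUnity_nine_pow u
  have hc := congrArg SU38.toMatrix (Subgroup.mem_center_iff.mp h SU38.cyc)
  rw [map_mul, map_mul _ _ SU38.cyc] at hc
  obtain ⟨X, hX⟩ : ∃ X, X = SU38.toMatrix (SL28.toSU38 e he hw A * torus u) := ⟨_, rfl⟩
  rw [← hX] at hc
  rw [map_mul, toMatrix_torus, toMatrix_toSU38] at hX
  have hsc := eq_scalar_of_commute_cyc hc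
    (by rw [hX]; simp [baseChange, baseChangeInv, blockEmb, Matrix.mul_apply, Fin.sum_univ_three])
    (by rw [hX]; simp [baseChange, baseChangeInv, blockEmb, Matrix.mul_apply, Fin.sum_univ_three])
  have h22 : X 2 2 = (u.1 : GF64) ^ 7 := by
    rw [hX]; simp [baseChange, baseChangeInv, blockEmb, Matrix.mul_apply, Fin.sum_univ_three]
  have hB : blockEmb e A * diagonal ![(u.1 : GF64), u.1, (u.1 : GF64) ^ 7] =
      (u.1 : GF64) ^ 7 • (1 : Matrix (Fin 3) (Fin 3) GF64) := by
    calc _ = (baseChangeInv w * baseChange w) *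
            (blockEmb e A * diagonal ![(u.1 : GF64), u.1, (u.1 : GF64) ^ 7]) *
            (baseChangeInv w * baseChange w) := by
          rw [baseChangeInv_mul hw, Matrix.one_mul, Matrix.mul_one]
      _ = baseChangeInv w * X * baseChange w := by
          rw [hX, Matrix.mul_assoc (_ * _) (baseChangeInv w) (diagonal _),
            baseChangeInv_mul_diagonal]
          simp only [Matrix.mul_assoc]
      _ = _ := by
          rw [hsc, h22]
          simp [baseChangeInv_mul hw]
  have hu0 : (u.1 : GF64) ≠ 0 := u.1.ne_zero
  have H := fun i j ↦ congrFun (congrFun hB i) j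
  have b00 := H 0 0
  have b01 := H 0 1
  have b10 := H 1 0
  have b11 := H 1 1
  simp [blockEmb] at b00 b01 b10 b11
  have hd := congrArg e A.det_coe
  rw [det_fin_two, b01] at hd
  simp only [map_mul, map_one, zero_mul, sub_zero] at hd
  have h3 : (u.1 : GF64) ^ 3 = 1 := by
    have : (u.1 : GF64) ^ 14 = u.1 ^ 2 := by
      linear_combination (u.1 : GF64) ^ 2 * hd - (u.1 : GF64) ^ 7 * b00
        - (e (A 0 0) * u.1) * b11
    have h12 : (u.1 : GF64) ^ 5 = u.1 ^ 2 := by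
      linear_combination this - (u.1 : GF64) ^ 5 * h9
    refine mul_right_cancel₀ (pow_ne_zero 2 hu0) ?_
    linear_combination h12
  have h7 : (u.1 : GF64) ^ 7 = u.1 := by
    linear_combination (u.1 : GF64) * ((u.1 : GF64) ^ 3 + 1) * h3
  rw [h7] at b00 b11
  refine ⟨?_, Subtype.ext <| Units.ext <| by simpa using h3⟩
  have c00 : A 0 0 = 1 := e.injective <| by
    rw [map_one]; exact mul_right_cancel₀ hu0 (by rw [b00, one_mul])
  have c11 : A 1 1 = 1 := e.injective <| by
    rw [map_one]; exact mul_right_cancel₀ hu0 (by rw [b11, one_mul])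
  ext i j
  fin_cases i <;> fin_cases j <;> simp [c00, c11, b01, b10]

end Embedding

lemma exists_injective_PSL28_prod_to_PSU38 :
    ∃ f : PSL28 × Multiplicative (ZMod 3) →* PSU38, Function.Injective f := by
  obtain ⟨z, hz⟩ := GF64.exists_orderOf_eq_nine
  obtain ⟨e, he⟩ := exists_ringHom_pow_eight
  have hz9 : z ^ 9 = 1 := hz ▸ pow_orderOf_eq_one z
  have hz3 : z ^ 3 ≠ 1 := fun h ↦ by
    have := orderOf_dvd_of_pow_eq_one h
    rw [hz] at this
    norm_num at this
  have hw : ((z ^ 3 : GF64ˣ) : GF64) ^ 2 + (z ^ 3 : GF64ˣ) + 1 = 0 := by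
    have h9 : (z : GF64) ^ 9 = 1 := congrArg Units.val hz9
    have hne : (z : GF64) ^ 3 - 1 ≠ 0 := fun h ↦
      hz3 <| Units.ext <| by simpa using sub_eq_zero.mp h
    refine mul_left_cancel₀ hne ?_
    push_cast
    linear_combination h9
  let u : rootsOfUnity 9 GF64 := ⟨z, (mem_rootsOfUnity 9 z).mpr hz9⟩
  let π : SU38 →* PSU38 := QuotientGroup.mk' (Subgroup.center SU38)
  have hπ {x : SU38} : π x = 1 ↔ x ∈ Subgroup.center SU38 := QuotientGroup.eq_one_iff x
  let φ := SL28.toSU38 e he hw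
  let t : PSU38 := π (torus u)
  have ht : orderOf t = 3 := by
    refine orderOf_eq_prime ?_ fun h ↦ hz3 ?_
    · rw [← map_pow, ← map_pow, hπ]
      exact torus_mem_center (Subtype.ext (by rw [← pow_mul]; exact hz9))
    · have := (eq_one_of_mul_torus_mem_center e he hw (A := 1) (u := u)
        (by rw [map_one, one_mul]; exact hπ.mp h)).2
      exact congrArg Subtype.val this
  have hpow (k : ℤ) : t ^ k = π (torus (u ^ k)) := by rw [map_zpow, map_zpow]
  let g := (π.comp φ).noncommCoprod (Subgroup.zpowers t).subtype (by
    rintro A ⟨_, k, rfl⟩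
    simpa [hpow] using (commute_toSU38_torus e he hw A (u ^ k)).map π)
  have hg : Function.Injective g := by
    refine (MonoidHom.noncommCoprod_injective _ _ _).mpr
      ⟨(injective_iff_map_eq_one _).mpr fun A hA ↦ ?_, Subtype.val_injective, ?_⟩
    · refine (eq_one_of_mul_torus_mem_center e he hw (A := A) (u := 1) ?_).1
      rw [map_one, mul_one]
      exact hπ.mp hA
    · rw [Subgroup.disjoint_def]
      rintro _ ⟨A, rfl⟩ ⟨⟨_, k, rfl⟩, hk⟩
      have hA : A = 1 := by
        refine (eq_one_of_mul_torus_mem_center e he hw (A := A) (u := u ^ (-k)) ?_).1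
        rw [← hπ, map_mul, ← hpow, _root_.zpow_neg, mul_inv_eq_one]
        exact hk.symm
      rw [hA, map_one]
  have hcard : Nat.card (Subgroup.zpowers t) = 3 := by rw [Nat.card_zpowers, ht]
  let α : PSL28 ≃* Matrix.SpecialLinearGroup (Fin 2) (GaloisField 2 3) :=
    (QuotientGroup.quotientMulEquivOfEq center_SL28_eq_bot).trans QuotientGroup.quotientBot
  let β : Multiplicative (ZMod 3) ≃* Subgroup.zpowers t :=
    mulEquivOfPrimeCardEq (p := 3) (by simp) hcard
  exact ⟨g.comp (α.prodCongr β).toMonoidHom, hg.comp (α.prodCongr β).injective⟩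

/-- 3·|PSL(2,8)| divides |PSU(3,8)|; indeed PSU(3,8) contains a subgroup isomorphic to
PSL(2,8) × ℤ/3. -/
theorem psl28_times_three_in_psu38 :
    (Nat.card PSL28 * 3 ∣ Nat.card PSU38) ∧
    ∃ H : Subgroup PSU38, Nonempty (H ≃* (PSL28 × Multiplicative (ZMod 3))) := by
  obtain ⟨f, hf⟩ := exists_injective_PSL28_prod_to_PSU38
  have i : f.range ≃* PSL28 × Multiplicative (ZMod 3) := (MonoidHom.ofInjective hf).symm
  refine ⟨?_, f.range, ⟨i⟩⟩
  have h := Subgroup.card_subgroup_dvd_card f.range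
  rwa [Nat.card_congr i.toEquiv, Nat.card_prod, Nat.card_congr Multiplicative.toAdd,
    Nat.card_zmod] at h
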